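/- Suppose $\tau$ is in the limit circle case at $a$ and $\theta_z,\phi_z$ is a real entire fundamental system with $W(\theta_z,\phi_z)=1$, $W(\theta_{z_1},\phi_{z_2})(a)=1$ and $W(\theta_{z_1},\theta_{z_2})(a)=W(\phi_{z_1},\phi_{z_2})(a)=0$ for all $z_1,z_2\in\mathbb{C}$. Then for each fixed $c\in(a,b)$, the entire functions $z\mapsto\theta_z(c)$, $z\mapsto\theta_z^{[1]}(c)$, $z\mapsto\phi_z(c)$, $z\mapsto\phi_z^{[1]}(c)$ belong to the Cartwright class (finite exponential type with finite logarithmic integral $\int_{\mathbb{R}} \ln_+|F(\lambda)|\,(1+\lambda^2)^{-1}d\lambda < \infty$). -/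

import Mathlib

open MeasureTheory Set Filter Complex Topology ComplexConjugate

noncomputable section

/-- `f` is locally absolutely continuous on `(a,b)` with a.e. derivative `g`,
encoded via the integral representation. -/
def HasACDeriv (a b : ℝ) (f g : ℝ → ℂ) : Prop :=
  ∀ x ∈ Set.Ioo a b, ∀ y ∈ Set.Ioo a b,
    IntervalIntegrable g volume y x ∧ f x = f y + ∫ t in y..x, g t

/-- `f` lies in the domain `𝔇_τ` with first quasi-derivative `fq = p (f' + s f)` and
`τ f = w`, encoded via the equivalent first order system
`(f, f^{[1]})' = ((-s, 1/p), (q - 0·r, s)) (f, f^{[1]}) - (0, r·w)`. -/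
structure SLSys (a b : ℝ) (p q r s : ℝ → ℝ) (f fq w : ℝ → ℂ) : Prop where
  fst : HasACDeriv a b f fun x => fq x / (p x : ℂ) - (s x : ℂ) * f x
  snd : HasACDeriv a b fq fun x => (s x : ℂ) * fq x + (q x : ℂ) * f x - (r x : ℂ) * w x

/-- Standing hypothesis on the coefficients `p, q, r, s` on `(a,b)`:
real-valued and measurable, `p⁻¹, q, r, s ∈ L¹_loc((a,b))`, `p ≠ 0` and `r > 0` a.e. -/
structure SLHyp (a b : ℝ) (p q r s : ℝ → ℝ) : Prop where
  lt : a < b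
  mp : Measurable p
  mq : Measurable q
  mr : Measurable r
  ms : Measurable s
  ip : ∀ x ∈ Set.Ioo a b, ∀ y ∈ Set.Ioo a b,
    IntervalIntegrable (fun t => (p t)⁻¹) volume y x
  iq : ∀ x ∈ Set.Ioo a b, ∀ y ∈ Set.Ioo a b, IntervalIntegrable q volume y x
  ir : ∀ x ∈ Set.Ioo a b, ∀ y ∈ Set.Ioo a b, IntervalIntegrable r volume y x
  is' : ∀ x ∈ Set.Ioo a b, ∀ y ∈ Set.Ioo a b, IntervalIntegrable s volume y x
  pne : ∀ᵐ t ∂(volume.restrict (Set.Ioo a b)), p t ≠ 0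
  rpos : ∀ᵐ t ∂(volume.restrict (Set.Ioo a b)), 0 < r t

/-- The modified Wronskian `W(f,g)(x) = f(x) g^{[1]}(x) - f^{[1]}(x) g(x)`. -/
def Wr (f fq g gq : ℝ → ℂ) (x : ℝ) : ℂ := f x * gq x - fq x * g x

/-- A real entire family of solutions of `(τ - z) u = 0`. -/
structure RESolFam (a b : ℝ) (p q r s : ℝ → ℝ) (φ φq : ℂ → ℝ → ℂ) : Prop where
  sol : ∀ z : ℂ, SLSys a b p q r s (φ z) (φq z) fun x => z * φ z x
  entire : ∀ x ∈ Set.Ioo a b,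
    (Differentiable ℂ fun z => φ z x) ∧ Differentiable ℂ fun z => φq z x
  real : ∀ z : ℂ, ∀ x ∈ Set.Ioo a b,
    φ (conj z) x = conj (φ z x) ∧ φq (conj z) x = conj (φq z x)

/-- The Cartwright class: entire, of finite exponential type, with finite
logarithmic integral `∫_ℝ ln₊ |F(λ)| (1+λ²)⁻¹ dλ < ∞`. -/
def CartwrightClass (F : ℂ → ℂ) : Prop :=
  Differentiable ℂ F ∧ (∃ C τ : ℝ, ∀ z : ℂ, ‖F z‖ ≤ C * Real.exp (τ * ‖z‖)) ∧
  Integrable (fun t : ℝ => Real.log (max 1 ‖F (t : ℂ)‖) / (1 + t ^ 2))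


lemma ac_ofReal {h : ℝ → ℝ} {y x : ℝ} (hh : AbsolutelyContinuousOnInterval h y x) :
    AbsolutelyContinuousOnInterval (fun t => ((h t : ℝ) : ℂ)) y x := by
  unfold AbsolutelyContinuousOnInterval at *
  simpa [Complex.dist_eq, ← Complex.ofReal_sub, Real.dist_eq] using hh

lemma ac_integral {g : ℝ → ℂ} {y x : ℝ} (hg : IntervalIntegrable g volume y x) :
    AbsolutelyContinuousOnInterval (fun t => ∫ v in y..t, g v) y x := by
  have hre : IntervalIntegrable (fun t => (g t).re) volume y x := ⟨hg.1.re, hg.2.re⟩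
  have him : IntervalIntegrable (fun t => (g t).im) volume y x := ⟨hg.1.im, hg.2.im⟩
  have h1 := ac_ofReal (hre.absolutelyContinuousOnInterval_intervalIntegral Set.left_mem_uIcc)
  have h2 := (ac_ofReal
    (him.absolutelyContinuousOnInterval_intervalIntegral Set.left_mem_uIcc)).const_smul Complex.I
  have h3 := h1.add h2
  have key : ∀ t ∈ uIcc y x, ∫ v in y..t, g v =
      ((∫ v in y..t, (g v).re : ℝ) : ℂ) + Complex.I • ((∫ v in y..t, (g v).im : ℝ) : ℂ) := by
    intro t ht
    have hgt : IntervalIntegrable g volume y t := hg.mono_set (uIcc_subset_uIcc_left ht)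
    rw [← intervalIntegral.integral_ofReal, ← intervalIntegral.integral_ofReal,
      ← intervalIntegral.integral_smul, ← intervalIntegral.integral_add]
    · congr 1; ext v
      simp [mul_comm Complex.I, Complex.re_add_im]
    · exact ⟨hgt.1.re.ofReal, hgt.2.re.ofReal⟩
    · have hii : IntervalIntegrable (fun v => (((g v).im : ℝ) : ℂ)) volume y t :=
        ⟨hgt.1.im.ofReal, hgt.2.im.ofReal⟩
      exact hii.smul Complex.I
  unfold AbsolutelyContinuousOnInterval at *
  refine h3.congr' ?_
  have : ∀ᶠ (E : ℕ × (ℕ → ℝ × ℝ)) in AbsolutelyContinuousOnInterval.totalLengthFilter ⊓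
      𝓟 (AbsolutelyContinuousOnInterval.disjWithin y x),
      E ∈ AbsolutelyContinuousOnInterval.disjWithin y x :=
    eventually_inf_principal.mpr (by simp)
  filter_upwards [this] with E hE
  obtain ⟨h, -⟩ := hE
  apply Finset.sum_congr rfl
  intro i hi
  have := h i hi
  rw [key _ this.1, key _ this.2]
  simp

lemma prod_int {g1 g2 : ℝ → ℂ} {y x : ℝ} (h1 : IntervalIntegrable g1 volume y x)
    (h2 : IntervalIntegrable g2 volume y x) (A B : ℂ) :
    (A + ∫ v in y..x, g1 v) * (B + ∫ v in y..x, g2 v) = A * B +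
      ∫ t in y..x, (g1 t * (B + ∫ v in y..t, g2 v) + (A + ∫ v in y..t, g1 v) * g2 t) := by
  have hconst : ∀ C : ℂ, AbsolutelyContinuousOnInterval (fun _ : ℝ => C) y x := by
    intro C
    unfold AbsolutelyContinuousOnInterval
    simpa using tendsto_const_nhds
  have a1 : AbsolutelyContinuousOnInterval (fun t => A + ∫ v in y..t, g1 v) y x :=
    (hconst A).add (ac_integral h1)
  have a2 : AbsolutelyContinuousOnInterval (fun t => B + ∫ v in y..t, g2 v) y x :=
    (hconst B).add (ac_integral h2)
  have a3 := a1.smul a2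
  have hI : IntervalIntegrable (fun t => g1 t * (B + ∫ v in y..t, g2 v) +
      (A + ∫ v in y..t, g1 v) * g2 t) volume y x :=
    (h1.mul_continuousOn a2.continuousOn).add (h2.continuousOn_mul a1.continuousOn)
  have a4 := a3.sub (ac_integral hI)
  obtain ⟨C, hC⟩ := a4.const_of_ae_hasDerivAt_zero (by
    filter_upwards [h1.ae_hasDerivAt_integral, h2.ae_hasDerivAt_integral,
      hI.ae_hasDerivAt_integral] with t e1 e2 e3 ht
    have d1 := (e1 ht y Set.left_mem_uIcc).const_add A
    have d2 := (e2 ht y Set.left_mem_uIcc).const_add B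
    have d3 := e3 ht y Set.left_mem_uIcc
    have := (d1.mul d2).sub d3
    rw [sub_self] at this
    exact this)
  have c1 := hC x Set.right_mem_uIcc
  have c2 := hC y Set.left_mem_uIcc
  simp at c1 c2
  rw [c2, ← c1]
  ring

lemma HasACDeriv.continuousOn {a b : ℝ} {f g : ℝ → ℂ} (h : HasACDeriv a b f g) :
    ContinuousOn f (Ioo a b) := by
  intro x hx
  obtain ⟨y, hy1, hy2⟩ := exists_between hx.1
  obtain ⟨w, hw1, hw2⟩ := exists_between hx.2
  have hy : y ∈ Ioo a b := ⟨hy1, hy2.trans hx.2⟩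
  have hw : w ∈ Ioo a b := ⟨hx.1.trans hw1, hw2⟩
  have hyw : y ≤ w := (hy2.trans hw1).le
  have hc := (ac_integral (h w hw y hy).1).continuousOn
  have hc2 : ContinuousAt (fun t => f y + ∫ v in y..t, g v) x := by
    apply ContinuousAt.add continuousAt_const
    apply hc.continuousAt
    rw [uIcc_of_le hyw]
    exact Icc_mem_nhds hy2 hw1
  refine (hc2.congr ?_).continuousWithinAt
  filter_upwards [Ioo_mem_nhds hx.1 hx.2] with t ht
  exact ((h t ht y hy).2).symm

lemma HasACDeriv.mul {a b : ℝ} {f1 g1 f2 g2 : ℝ → ℂ} (h1 : HasACDeriv a b f1 g1)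
    (h2 : HasACDeriv a b f2 g2) :
    HasACDeriv a b (fun t => f1 t * f2 t) (fun t => g1 t * f2 t + f1 t * g2 t) := by
  intro x hx y hy
  have hsub : uIcc y x ⊆ Ioo a b := by
    intro t ht
    rcases le_total y x with h | h
    · rw [uIcc_of_le h] at ht; exact ⟨hy.1.trans_le ht.1, ht.2.trans_lt hx.2⟩
    · rw [uIcc_of_ge h] at ht; exact ⟨hx.1.trans_le ht.1, ht.2.trans_lt hy.2⟩
  refine ⟨((h1 x hx y hy).1.mul_continuousOn (h2.continuousOn.mono hsub)).add
    ((h2 x hx y hy).1.continuousOn_mul (h1.continuousOn.mono hsub)), ?_⟩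
  have := prod_int (h1 x hx y hy).1 (h2 x hx y hy).1 (f1 y) (f2 y)
  rw [← (h1 x hx y hy).2, ← (h2 x hx y hy).2] at this
  beta_reduce
  rw [this]
  congr 1
  apply intervalIntegral.integral_congr
  intro t ht
  have ht := hsub ht
  simp only
  rw [← (h1 t ht y hy).2, ← (h2 t ht y hy).2]

lemma HasACDeriv.sub {a b : ℝ} {f1 g1 f2 g2 : ℝ → ℂ} (h1 : HasACDeriv a b f1 g1)
    (h2 : HasACDeriv a b f2 g2) :
    HasACDeriv a b (fun t => f1 t - f2 t) (fun t => g1 t - g2 t) := by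
  intro x hx y hy
  refine ⟨(h1 x hx y hy).1.sub (h2 x hx y hy).1, ?_⟩
  rw [intervalIntegral.integral_sub (h1 x hx y hy).1 (h2 x hx y hy).1]
  beta_reduce
  rw [(h1 x hx y hy).2, (h2 x hx y hy).2]
  ring

lemma HasACDeriv.add {a b : ℝ} {f1 g1 f2 g2 : ℝ → ℂ} (h1 : HasACDeriv a b f1 g1)
    (h2 : HasACDeriv a b f2 g2) :
    HasACDeriv a b (fun t => f1 t + f2 t) (fun t => g1 t + g2 t) := by
  intro x hx y hy
  refine ⟨(h1 x hx y hy).1.add (h2 x hx y hy).1, ?_⟩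
  rw [intervalIntegral.integral_add (h1 x hx y hy).1 (h2 x hx y hy).1]
  beta_reduce
  rw [(h1 x hx y hy).2, (h2 x hx y hy).2]
  ring

lemma HasACDeriv.const_mul {a b : ℝ} {f g : ℝ → ℂ} (h1 : HasACDeriv a b f g) (C : ℂ) :
    HasACDeriv a b (fun t => C * f t) (fun t => C * g t) := by
  intro x hx y hy
  refine ⟨(h1 x hx y hy).1.const_mul C, ?_⟩
  beta_reduce
  rw [intervalIntegral.integral_const_mul, (h1 x hx y hy).2]
  ring

/-- Lagrange identity. -/
lemma lagrange {a b : ℝ} {p q r s : ℝ → ℝ} {u uq v vq : ℝ → ℂ} {z1 z2 : ℂ}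
    (hu : SLSys a b p q r s u uq fun x => z1 * u x)
    (hv : SLSys a b p q r s v vq fun x => z2 * v x) :
    HasACDeriv a b (Wr u uq v vq) (fun t => (z1 - z2) * ((r t : ℂ) * (u t * v t))) := by
  have h := (hu.fst.mul hv.snd).sub (hu.snd.mul hv.fst)
  convert h using 1
  · rfl
  · ext t
    ring

lemma SLSys.comb {a b : ℝ} {p q r s : ℝ → ℝ} {u uq v vq : ℝ → ℂ} {z : ℂ}
    (hu : SLSys a b p q r s u uq fun x => z * u x)
    (hv : SLSys a b p q r s v vq fun x => z * v x) (A B : ℂ) :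
    SLSys a b p q r s (fun x => A * u x + B * v x) (fun x => A * uq x + B * vq x)
      fun x => z * (A * u x + B * v x) := by
  constructor
  · convert (hu.fst.const_mul A).add (hv.fst.const_mul B) using 1
    ext t; ring
  · convert (hu.snd.const_mul A).add (hv.snd.const_mul B) using 1
    ext t; ring


lemma gron_half {N k : ℝ → ℝ} {y x : ℝ} (hyx : y ≤ x) (hN : ContinuousOn N (Icc y x))
    (hk : IntervalIntegrable k volume y x) (hk0 : ∀ t, 0 ≤ k t)
    (hineq : ∀ t ∈ Icc y x, N t ≤ N y + ∫ u in y..t, k u * N u)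
    (hN0 : 0 ≤ N y)
    (hh : ∫ u in y..x, k u ≤ 1 / 2) : N x ≤ 2 * N y := by
  obtain ⟨m, hm, hmax⟩ := isCompact_Icc.exists_isMaxOn (nonempty_Icc.2 hyx) hN
  have hmx : ∀ t ∈ Icc y x, N t ≤ N m := fun t ht => hmax ht
  have hNm0 : 0 ≤ N m := hN0.trans (hmx y (left_mem_Icc.2 hyx))
  have hkm : IntervalIntegrable k volume y m := by
    apply hk.mono_set
    rw [uIcc_of_le hyx, uIcc_of_le hm.1]
    exact Icc_subset_Icc_right hm.2
  have h1 : ∫ u in y..m, k u * N u ≤ ∫ u in y..m, k u * N m := by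
    apply intervalIntegral.integral_mono_on hm.1
    · apply hkm.mul_continuousOn
      rw [uIcc_of_le hm.1]
      exact hN.mono (Icc_subset_Icc_right hm.2)
    · exact hkm.mul_const _
    · intro u hu
      exact mul_le_mul_of_nonneg_left (hmx u ⟨hu.1, hu.2.trans hm.2⟩) (hk0 u)
  rw [intervalIntegral.integral_mul_const] at h1
  have h2 : ∫ u in y..m, k u ≤ ∫ u in y..x, k u :=
    intervalIntegral.integral_mono_interval le_rfl hm.1 hm.2
      (Eventually.of_forall fun t => hk0 t) hk
  have h3 := hineq m hm
  have h4 := hmx x (right_mem_Icc.2 hyx)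
  nlinarith

lemma gron {N k : ℝ → ℝ} {c : ℝ} (hk0 : ∀ t, 0 ≤ k t) (n : ℕ) :
    ∀ y : ℝ, y ≤ c → ContinuousOn N (Icc y c) → IntervalIntegrable k volume y c →
    (∀ s ∈ Icc y c, ∀ t ∈ Icc s c, N t ≤ N s + ∫ u in s..t, k u * N u) →
    (∀ t ∈ Icc y c, 0 ≤ N t) →
    ∫ u in y..c, k u ≤ (n + 1 : ℝ) / 2 → N c ≤ 2 ^ (n + 1) * N y := by
  induction n with
  | zero =>
    intro y hy hN hk hineq hN0 hh
    have := gron_half hy hN hk hk0 (fun t ht => hineq y (left_mem_Icc.2 hy) t ht)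
      (hN0 y (left_mem_Icc.2 hy)) (by simpa using hh)
    simpa using this
  | succ n ih =>
    intro y hy hN hk hineq hN0 hh
    have hNy := hN0 y (left_mem_Icc.2 hy)
    by_cases hs : ∫ u in y..c, k u ≤ (n + 1 : ℝ) / 2
    · have := ih y hy hN hk hineq hN0 hs
      have h2 : (2 : ℝ) ^ (n + 1) ≤ 2 ^ (n + 1 + 1) :=
        pow_le_pow_right₀ (by norm_num) (by omega)
      nlinarith
    · push Not at hs
      have hcont : ContinuousOn (fun t => ∫ u in t..c, k u) (Icc y c) := by
        have := (intervalIntegral.continuousOn_primitive_interval_left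
          (f := k) (a := y) (b := c) (μ := volume) (by
            rw [uIcc_of_le hy]
            exact (intervalIntegrable_iff_integrableOn_Icc_of_le hy).1 hk))
        rwa [uIcc_of_le hy] at this
      obtain ⟨t, ht, hte⟩ := intermediate_value_Icc' hy hcont
        (show ((n + 1 : ℝ) / 2) ∈ Icc _ _ from ⟨by simp; positivity, hs.le⟩)
      simp only at hte
      have hk1 : IntervalIntegrable k volume y t := by
        apply hk.mono_set
        rw [uIcc_of_le hy, uIcc_of_le ht.1]
        exact Icc_subset_Icc_right ht.2
      have hk2 : IntervalIntegrable k volume t c := by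
        apply hk.mono_set
        rw [uIcc_of_le hy, uIcc_of_le ht.2]
        exact Icc_subset_Icc_left ht.1
      have hadd := intervalIntegral.integral_add_adjacent_intervals hk1 hk2
      have e1 : N t ≤ 2 * N y := by
        apply gron_half ht.1 (hN.mono (Icc_subset_Icc_right ht.2)) hk1 hk0 _ hNy
        · push_cast at hh
          linarith
        · intro v hv
          exact hineq y (left_mem_Icc.2 hy) v ⟨hv.1, hv.2.trans ht.2⟩
      have e2 := ih t ht.2 (hN.mono (Icc_subset_Icc_left ht.1)) hk2
        (fun s hs v hv => hineq s ⟨ht.1.trans hs.1, hs.2⟩ v hv)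
        (fun v hv => hN0 v ⟨ht.1.trans hv.1, hv.2⟩) hte.le
      calc N c ≤ 2 ^ (n + 1) * N t := e2
        _ ≤ 2 ^ (n + 1) * (2 * N y) := by gcongr
        _ = _ := by ring

lemma HasACDeriv.norm_le {a b : ℝ} {f g : ℝ → ℂ} (h : HasACDeriv a b f g) {s t : ℝ}
    (hs : s ∈ Ioo a b) (ht : t ∈ Ioo a b) (hst : s ≤ t) :
    ‖f t‖ ≤ ‖f s‖ + ∫ u in s..t, ‖g u‖ := by
  rw [(h t ht s hs).2]
  exact (norm_add_le _ _).trans (add_le_add_right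
    (intervalIntegral.norm_integral_le_integral_norm hst) _)

lemma exp_type {a b : ℝ} {p q r s : ℝ → ℝ} {θ θq φ φq v vq : ℝ → ℂ} {z : ℂ}
    (hθ : SLSys a b p q r s θ θq fun x => 0 * θ x)
    (hφ : SLSys a b p q r s φ φq fun x => 0 * φ x)
    (hv : SLSys a b p q r s v vq fun x => z * v x)
    (hW : ∀ x ∈ Ioo a b, Wr θ θq φ φq x = 1)
    {c : ℝ} (hc : c ∈ Ioo a b)
    (hint : IntegrableOn (fun x => (‖θ x‖ + ‖φ x‖) ^ 2 * |r x|) (Ioo a c))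
    {α β : ℂ} (hα : Tendsto (Wr θ θq v vq) (𝓝[>] a) (𝓝 α))
    (hβ : Tendsto (Wr φ φq v vq) (𝓝[>] a) (𝓝 β)) (hαβ : ‖α‖ + ‖β‖ = 1) :
    ‖Wr θ θq v vq c‖ + ‖Wr φ φq v vq c‖ ≤ Real.exp 2 *
      Real.exp ((2 * ∫ x in Ioo a c, (‖θ x‖ + ‖φ x‖) ^ 2 * |r x|) * ‖z‖) := by
  set k : ℝ → ℝ := fun x => (‖θ x‖ + ‖φ x‖) ^ 2 * |r x| with hk
  set K := ∫ x in Ioo a c, k x with hK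
  have hk0 : ∀ t, 0 ≤ k t := fun t => by positivity
  have hK0 : 0 ≤ K := integral_nonneg hk0
  have LA := lagrange hθ hv
  have LB := lagrange hφ hv
  set A := Wr θ θq v vq with hA
  set B := Wr φ φq v vq with hB
  set N : ℝ → ℝ := fun t => ‖A t‖ + ‖B t‖ with hN
  have hvb : ∀ t ∈ Ioo a b, ‖v t‖ ≤ (‖θ t‖ + ‖φ t‖) * N t := by
    intro t ht
    have e : v t = A t * φ t - B t * θ t := by
      have := hW t ht
      simp only [hA, hB, Wr] at *
      linear_combination (-v t) * this
    rw [e]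
    refine (norm_sub_le _ _).trans ?_
    simp only [norm_mul, hN]
    nlinarith [norm_nonneg (A t), norm_nonneg (B t), norm_nonneg (θ t), norm_nonneg (φ t),
      mul_nonneg (norm_nonneg (A t)) (norm_nonneg (θ t)),
      mul_nonneg (norm_nonneg (B t)) (norm_nonneg (φ t))]
  have hNc : ContinuousOn N (Ioo a b) := LA.continuousOn.norm.add LB.continuousOn.norm
  have hlim : Tendsto N (𝓝[>] a) (𝓝 1) := by
    rw [← hαβ]; exact hα.norm.add hβ.norm
  have hkint : ∀ y ∈ Ioo a c, IntervalIntegrable k volume y c := by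
    intro y hy
    rw [intervalIntegrable_iff_integrableOn_Ioo_of_le hy.2.le]
    exact hint.mono_set (Ioo_subset_Ioo_left hy.1.le)
  have hkle : ∀ y ∈ Ioo a c, ∫ u in y..c, k u ≤ K := by
    intro y hy
    rw [intervalIntegral.integral_of_le hy.2.le, integral_Ioc_eq_integral_Ioo]
    exact setIntegral_mono_set hint (Eventually.of_forall hk0)
      (Ioo_subset_Ioo_left hy.1.le).eventuallyLE
  set n := ⌈2 * K * ‖z‖⌉₊ with hn
  have main : ∀ y ∈ Ioo a c, N c ≤ 2 ^ (n + 1) * N y := by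
    intro y hy
    have hsub : Icc y c ⊆ Ioo a b := fun t ht => ⟨hy.1.trans_le ht.1, ht.2.trans_lt hc.2⟩
    apply gron (N := N) (k := fun t => ‖z‖ * k t) (fun t => mul_nonneg (norm_nonneg _) (hk0 t)) n y
      hy.2.le (hNc.mono hsub) ((hkint y hy).const_mul _)
    · intro σ hσ t ht
      have hσ' := hsub hσ
      have ht' : t ∈ Ioo a b := hsub ⟨hσ.1.trans ht.1, ht.2⟩
      have h1 := LA.norm_le hσ' ht' ht.1
      have h2 := LB.norm_le hσ' ht' ht.1
      have hkσ : IntervalIntegrable (fun u => ‖z‖ * k u * N u) volume σ t := by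
        apply IntervalIntegrable.mul_continuousOn
        · apply IntervalIntegrable.const_mul
          apply (hkint y hy).mono_set
          rw [uIcc_of_le ht.1, uIcc_of_le hy.2.le]
          exact Icc_subset_Icc hσ.1 ht.2
        · apply hNc.mono
          rw [uIcc_of_le ht.1]
          exact fun u hu => hsub ⟨hσ.1.trans hu.1, hu.2.trans ht.2⟩
      have i1 := (LA t ht' σ hσ').1.norm
      have i2 := (LB t ht' σ hσ').1.norm
      have h3 := intervalIntegral.integral_mono_on ht.1 (i1.add i2) hkσ (by
        intro u hu
        have hu' := hsub ⟨hσ.1.trans hu.1, hu.2.trans ht.2⟩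
        have hb := hvb u hu'
        simp only [zero_sub, norm_mul, norm_neg, Complex.norm_real, Real.norm_eq_abs]
        have h0 : 0 ≤ ‖z‖ * |r u| * (‖θ u‖ + ‖φ u‖) := by positivity
        have := mul_le_mul_of_nonneg_left hb h0
        simp only [hk]
        nlinarith)
      rw [intervalIntegral.integral_add i1 i2] at h3
      simp only [hN] at *
      linarith
    · intro t ht
      positivity
    · rw [intervalIntegral.integral_const_mul]
      have h1 := hkle y hy
      have h2 := Nat.le_ceil (2 * K * ‖z‖)
      rw [← hn] at h2
      have h3 := mul_le_mul_of_nonneg_left h1 (norm_nonneg z)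
      linarith
  have hfin : N c ≤ 2 ^ (n + 1) * 1 := by
    refine ge_of_tendsto (hlim.const_mul (2 ^ (n + 1))) ?_
    filter_upwards [Ioo_mem_nhdsGT hc.1] with y hy
    exact main y hy
  refine hfin.trans ?_
  rw [mul_one, ← Real.exp_add]
  have h2 : (2 : ℝ) ≤ Real.exp 1 := by
    have := Real.add_one_le_exp (1 : ℝ); linarith
  calc (2 : ℝ) ^ (n + 1) ≤ (Real.exp 1) ^ (n + 1) := by gcongr
    _ = Real.exp ((n + 1 : ℕ) : ℝ) := by rw [← Real.exp_nat_mul, mul_one]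
    _ ≤ _ := by
      apply Real.exp_le_exp.2
      have := Nat.ceil_lt_add_one (a := 2 * K * ‖z‖) (by positivity)
      push_cast
      rw [← hn] at this
      linarith


lemma herglotz_dom {m : ℂ → ℂ} (hm : DifferentiableOn ℂ m {z : ℂ | 0 < z.im})
    (hne : ∀ z : ℂ, 0 < z.im → (m z).im ≠ 0) :
    ∃ M : ℂ → ℂ, DifferentiableOn ℂ M {z : ℂ | 0 < z.im} ∧
      ∀ z : ℂ, 0 < z.im → 1 ≤ ‖M z‖ ∧ ‖m z‖ ≤ ‖M z‖ := by
  have hpre : IsPreconnected {z : ℂ | 0 < z.im} := (convex_halfSpace_im_gt 0).isPreconnected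
  have hcont : ContinuousOn (fun z => (m z).im) {z : ℂ | 0 < z.im} :=
    Complex.continuous_im.comp_continuousOn hm.continuousOn
  have aux : ∀ w : ℂ, 0 < w.im → 1 ≤ ‖w + I‖ ∧ ‖w‖ ≤ ‖w + I‖ := by
    intro w hw
    constructor
    · have := Complex.abs_im_le_norm (w + I)
      have h2 := le_abs_self (w + I).im
      simp at this h2
      linarith
    · apply le_of_sq_le_sq _ (norm_nonneg _)
      rw [← Complex.normSq_eq_norm_sq, ← Complex.normSq_eq_norm_sq, Complex.normSq_apply,
        Complex.normSq_apply]
      simp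
      nlinarith
  by_cases hpos : ∀ z : ℂ, 0 < z.im → 0 < (m z).im
  · exact ⟨fun z => m z + I, hm.add_const _, fun z hz => aux _ (hpos z hz)⟩
  · push Not at hpos
    obtain ⟨z0, hz0, hz0'⟩ := hpos
    have hneg : ∀ z : ℂ, 0 < z.im → (m z).im < 0 := by
      intro z hz
      by_contra hcon
      push Not at hcon
      obtain ⟨y, hy, hy'⟩ := hpre.intermediate_value (show z0 ∈ _ from hz0) (show z ∈ _ from hz)
        hcont (show (0 : ℝ) ∈ Icc _ _ from ⟨hz0', hcon⟩)
      exact hne y hy hy'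
    refine ⟨fun z => -m z + I, hm.neg.add_const _, fun z hz => ?_⟩
    have := aux (-m z) (by simpa using hneg z hz)
    simpa using this

def cay (w : ℂ) : ℂ := I * ((1 + w) / (1 - w))

lemma cay_im {w : ℂ} (hw : ‖w‖ < 1) : 0 < (cay w).im := by
  have h1 : (1 - w) ≠ 0 := by
    intro h
    have : w = 1 := by linear_combination -h
    rw [this] at hw; simp at hw
  have h2 : 0 < Complex.normSq (1 - w) := Complex.normSq_pos.2 h1
  have h3 : Complex.normSq w < 1 := by
    rw [Complex.normSq_eq_norm_sq]; nlinarith [norm_nonneg w]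
  rw [Complex.normSq_apply] at h3
  unfold cay
  rw [Complex.I_mul_im, Complex.div_re, ← add_div]
  apply div_pos _ h2
  simp
  nlinarith

lemma cay_diff {w : ℂ} (hw : w ≠ 1) : DifferentiableAt ℂ cay w := by
  unfold cay
  have : (1 - w) ≠ 0 := sub_ne_zero.2 hw.symm
  fun_prop (disch := assumption)

lemma cay_circle (t : ℝ) : cay (circleMap 0 1 (2 * Real.arctan t + Real.pi)) = t := by
  have h0 : (1 + t ^ 2 : ℝ) ≠ 0 := by positivity
  have hc : Real.cos (2 * Real.arctan t + Real.pi) = -((1 - t ^ 2) / (1 + t ^ 2)) := by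
    rw [Real.cos_add_pi, Real.cos_two_mul, Real.cos_sq_arctan]
    field_simp
    ring
  have hs : Real.sin (2 * Real.arctan t + Real.pi) = -(2 * t / (1 + t ^ 2)) := by
    rw [Real.sin_add_pi, Real.sin_two_mul]
    have : Real.sin (Real.arctan t) = t * Real.cos (Real.arctan t) := by
      rw [Real.sin_arctan, Real.cos_arctan]; ring
    rw [this]
    have h2 := Real.cos_sq_arctan t
    rw [show 2 * (t * Real.cos (Real.arctan t)) * Real.cos (Real.arctan t) =
      2 * t * Real.cos (Real.arctan t) ^ 2 by ring, h2]
    ring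
  have e : circleMap 0 1 (2 * Real.arctan t + Real.pi) =
      -((1 - (t : ℂ) ^ 2) / (1 + (t : ℂ) ^ 2)) + -(2 * t / (1 + (t : ℂ) ^ 2)) * I := by
    rw [circleMap, Complex.exp_mul_I, ← Complex.ofReal_cos, ← Complex.ofReal_sin, hc, hs]
    push_cast
    ring
  have h0' : (1 + (t : ℂ) ^ 2) ≠ 0 := by exact_mod_cast h0
  have h4 : (1 : ℂ) + t * I ≠ 0 := by
    intro h
    have := congrArg Complex.re h
    simp at this
  have h5 : 1 - circleMap 0 1 (2 * Real.arctan t + Real.pi) =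
      2 * (1 + t * I) / (1 + (t : ℂ) ^ 2) := by
    rw [e]; field_simp; ring
  have h6 : 1 + circleMap 0 1 (2 * Real.arctan t + Real.pi) =
      (-t * I) * (2 * (1 + t * I) / (1 + (t : ℂ) ^ 2)) := by
    rw [e]; field_simp; ring_nf
    simp only [Complex.I_sq]; ring
  have h7 : 2 * (1 + t * I) / (1 + (t : ℂ) ^ 2) ≠ 0 :=
    div_ne_zero (mul_ne_zero two_ne_zero h4) h0'
  unfold cay
  rw [h5, h6, mul_div_cancel_right₀ _ h7]
  linear_combination (-(t : ℂ)) * Complex.I_sq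

lemma circleMap_ne_one {α : ℝ} (hα : α ∈ Ioo 0 (2 * Real.pi)) : circleMap 0 1 α ≠ 1 := by
  intro h
  have h' : Real.cos α = 1 := by
    have := congrArg Complex.re h
    rw [circleMap, Complex.exp_mul_I, ← Complex.ofReal_cos, ← Complex.ofReal_sin] at this
    simpa [-Complex.ofReal_cos, -Complex.ofReal_sin] using this
  rw [Real.cos_eq_one_iff_of_lt_of_lt (by linarith [hα.1, Real.pi_pos]) hα.2] at h'
  exact hα.1.ne' h'

lemma log_int {f H : ℂ → ℂ} (hf : Continuous f)
    (hH : DifferentiableOn ℂ H {z : ℂ | 0 < z.im})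
    (h1 : ∀ z : ℂ, 0 < z.im → 1 ≤ ‖H z‖) (h2 : ∀ z : ℂ, 0 < z.im → ‖f z‖ ^ 2 ≤ ‖H z‖) :
    Integrable (fun t : ℝ => Real.log (max 1 ‖f (t : ℂ)‖) / (1 + t ^ 2)) := by
  set L : ℂ → ℝ := fun w => Real.log (max 1 ‖f (cay w)‖) with hL
  have hmaxpos : ∀ w, 0 < max 1 ‖f (cay w)‖ := fun w => lt_max_of_lt_left one_pos
  have hLpos : ∀ w, 0 ≤ L w := fun w => Real.log_nonneg (le_max_left _ _)
  have hLcont : ∀ w : ℂ, w ≠ 1 → ContinuousAt L w := by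
    intro w hw
    have : ContinuousAt (fun w => max 1 ‖f (cay w)‖) w :=
      continuousAt_const.max ((hf.continuousAt.comp (cay_diff hw).continuousAt).norm)
    exact this.log (hmaxpos w).ne'
  have hLle : ∀ w : ℂ, ‖w‖ < 1 → L w ≤ 1 / 2 * Real.log ‖H (cay w)‖ := by
    intro w hw
    have hi := cay_im hw
    have e : L w = 1 / 2 * Real.log ((max 1 ‖f (cay w)‖) ^ 2) := by
      rw [Real.log_pow]; push_cast; ring
    rw [e]
    have : (max 1 ‖f (cay w)‖) ^ 2 ≤ ‖H (cay w)‖ := by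
      rcases max_cases 1 ‖f (cay w)‖ with h | h
      · rw [h.1]; simpa using h1 _ hi
      · rw [h.1]; exact h2 _ hi
    have := Real.log_le_log (by have := hmaxpos w; positivity) this
    linarith
  set ρ : ℕ → ℝ := fun n => 1 - 1 / ((n : ℝ) + 1 + 1) with hρ
  have hρ1 : ∀ n, ρ n < 1 := by
    intro n; simp only [hρ]; have : 0 < 1 / ((n : ℝ) + 1 + 1) := by positivity
    linarith
  have hρ0 : ∀ n, 0 ≤ ρ n := by
    intro n; simp only [hρ]
    have : 1 / ((n : ℝ) + 1 + 1) ≤ 1 := by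
      rw [div_le_one (by positivity)]; linarith [(Nat.cast_nonneg n : (0 : ℝ) ≤ n)]
    linarith
  have hρlim : Tendsto ρ atTop (𝓝 1) := by
    have := (tendsto_one_div_add_atTop_nhds_zero_nat (𝕜 := ℝ)).comp (tendsto_add_atTop_nat 1)
    have h3 := this.const_sub 1
    simp only [sub_zero] at h3
    refine h3.congr fun n => ?_
    simp [hρ]
  have hnorm : ∀ n α, ‖circleMap 0 (ρ n) α‖ < 1 := by
    intro n α
    rw [norm_circleMap_zero, abs_of_nonneg (hρ0 n)]; exact hρ1 n
  have hne1 : ∀ w : ℂ, ‖w‖ < 1 → w ≠ 1 := by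
    rintro w hw rfl; simp at hw
  set G : ℕ → ℝ → ℝ := fun n α => L (circleMap 0 (ρ n) α) with hG
  have hGc : ∀ n, Continuous (G n) := by
    intro n
    rw [continuous_iff_continuousAt]
    intro α
    exact ContinuousAt.comp (f := circleMap 0 (ρ n)) (hLcont _ (hne1 _ (hnorm n α)))
      (continuous_circleMap 0 (ρ n)).continuousAt
  have hbound : ∀ n, ∫⁻ α in Ioo 0 (2 * Real.pi), ‖G n α‖ₑ ≤
      ENNReal.ofReal (2 * Real.pi * (1 / 2 * Real.log ‖H (cay 0)‖)) := by
    intro n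
    have hH' : AnalyticOnNhd ℂ (fun w => H (cay w)) (Metric.ball 0 1) := by
      apply DifferentiableOn.analyticOnNhd _ Metric.isOpen_ball
      intro w hw
      have hw' : ‖w‖ < 1 := by simpa using hw
      refine DifferentiableWithinAt.comp (t := {z : ℂ | 0 < z.im}) w (hH _ (cay_im hw'))
        (cay_diff (hne1 w hw')).differentiableWithinAt ?_
      intro w' hw2
      exact cay_im (by simpa using hw2)
    have hsub : Metric.closedBall (0 : ℂ) |ρ n| ⊆ Metric.ball 0 1 := by
      apply Metric.closedBall_subset_ball
      rw [abs_of_nonneg (hρ0 n)]; exact hρ1 n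
    have hHne : ∀ w ∈ Metric.ball (0 : ℂ) 1, H (cay w) ≠ 0 := by
      intro w hw h0
      have := h1 _ (cay_im (w := w) (by simpa using hw))
      rw [h0] at this; simp at this; linarith
    have havg := (hH'.mono hsub).circleAverage_log_norm_of_ne_zero (fun w hw => hHne w (hsub hw))
    rw [Real.circleAverage_def, smul_eq_mul] at havg
    have hint2 : ∫ α in 0..2 * Real.pi, Real.log ‖H (cay (circleMap 0 (ρ n) α))‖ =
        2 * Real.pi * Real.log ‖H (cay 0)‖ := by
      rw [← havg]; field_simp
    have hHc : Continuous fun α => Real.log ‖H (cay (circleMap 0 (ρ n) α))‖ := by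
      rw [continuous_iff_continuousAt]
      intro α
      have hb : circleMap 0 (ρ n) α ∈ Metric.ball (0 : ℂ) 1 := by simpa using hnorm n α
      have hco : ContinuousAt (fun α => H (cay (circleMap 0 (ρ n) α))) α :=
        ContinuousAt.comp (f := circleMap 0 (ρ n)) (hH' _ hb).continuousAt
          (continuous_circleMap 0 (ρ n)).continuousAt
      exact hco.norm.log (norm_ne_zero_iff.2 (hHne _ hb))
    have hle : ∫ α in 0..2 * Real.pi, G n α ≤
        ∫ α in 0..2 * Real.pi, 1 / 2 * Real.log ‖H (cay (circleMap 0 (ρ n) α))‖ := by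
      apply intervalIntegral.integral_mono_on Real.two_pi_pos.le
        ((hGc n).intervalIntegrable _ _)
        ((continuous_const.mul hHc).intervalIntegrable _ _)
      intro α _
      exact hLle _ (hnorm n α)
    rw [intervalIntegral.integral_const_mul, hint2] at hle
    have hGi : IntegrableOn (G n) (Ioo 0 (2 * Real.pi)) :=
      ((hGc n).integrableOn_Icc).mono_set Ioo_subset_Icc_self
    have : ∫⁻ α in Ioo 0 (2 * Real.pi), ‖G n α‖ₑ = ENNReal.ofReal (∫ α in 0..2 * Real.pi, G n α) := by
      rw [intervalIntegral.integral_of_le Real.two_pi_pos.le, integral_Ioc_eq_integral_Ioo,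
        ofReal_integral_eq_lintegral_ofReal hGi (Eventually.of_forall fun α => hLpos _)]
      congr 1; ext α
      rw [Real.enorm_of_nonneg (hLpos _)]
    rw [this]
    apply ENNReal.ofReal_le_ofReal
    linarith
  have hg : IntegrableOn (fun α => L (circleMap 0 1 α)) (Ioo 0 (2 * Real.pi)) := by
    apply integrable_of_tendsto (G := G)
    · filter_upwards [ae_restrict_mem measurableSet_Ioo] with α hα
      have h3 : Tendsto (fun n => circleMap 0 (ρ n) α) atTop (𝓝 (circleMap 0 1 α)) := by
        have : Continuous fun R : ℝ => circleMap 0 R α := by unfold circleMap; fun_prop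
        exact (this.tendsto 1).comp hρlim
      exact (hLcont _ (circleMap_ne_one hα)).tendsto.comp h3
    · intro n; exact (hGc n).aestronglyMeasurable
    · apply ne_top_of_le_ne_top ENNReal.ofReal_ne_top
      refine (liminf_le_liminf (Eventually.of_forall hbound)).trans_eq ?_
      exact liminf_const _
  have himg : (fun t : ℝ => 2 * Real.arctan t + Real.pi) '' univ = Ioo 0 (2 * Real.pi) := by
    ext α
    constructor
    · rintro ⟨t, -, rfl⟩
      have := Real.neg_pi_div_two_lt_arctan t
      have := Real.arctan_lt_pi_div_two t
      constructor <;> simp only <;> linarith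
    · intro hα
      refine ⟨Real.tan ((α - Real.pi) / 2), mem_univ _, ?_⟩
      simp only
      rw [Real.arctan_tan (by linarith [hα.1]) (by linarith [hα.2])]
      ring
  rw [← himg, integrableOn_image_iff_integrableOn_abs_deriv_smul MeasurableSet.univ
    (f' := fun t => 2 * (1 / (1 + t ^ 2)))
    (fun t _ => (((Real.hasDerivAt_arctan t).const_mul 2).add_const _).hasDerivWithinAt)
    (by
      intro t _ u _ h
      simp only at h
      exact Real.arctan_injective (by linarith)), integrableOn_univ] at hg
  refine (hg.const_mul (1 / 2)).congr (Eventually.of_forall fun t => ?_)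
  simp only [hL, smul_eq_mul]
  rw [cay_circle, abs_of_nonneg (by positivity)]
  ring

lemma im_div_ne {f g : ℂ} (h : (conj f * g).im ≠ 0) : f ≠ 0 ∧ (g / f).im ≠ 0 := by
  have hf : f ≠ 0 := by rintro rfl; simp at h
  refine ⟨hf, ?_⟩
  have e : (g / f) = ((Complex.normSq f)⁻¹ : ℝ) * (conj f * g) := by
    rw [div_eq_mul_inv, Complex.inv_def]; push_cast; ring
  rw [e, Complex.im_ofReal_mul]
  exact mul_ne_zero (inv_ne_zero (Complex.normSq_pos.2 hf).ne') h

lemma log_f {f g h k : ℂ → ℂ} (hf : Differentiable ℂ f) (hg : Differentiable ℂ g)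
    (hh : Differentiable ℂ h) (hk : Differentiable ℂ k)
    (hdet : ∀ z, f z * k z - g z * h z = 1)
    (h1 : ∀ z : ℂ, 0 < z.im → (conj (f z) * g z).im ≠ 0)
    (h2 : ∀ z : ℂ, 0 < z.im → (conj (g z) * k z).im ≠ 0)
    (h3 : ∀ z : ℂ, 0 < z.im → (conj (f z) * h z).im ≠ 0) :
    Integrable (fun t : ℝ => Real.log (max 1 ‖f (t : ℂ)‖) / (1 + t ^ 2)) := by
  obtain ⟨M1, d1, b1⟩ := herglotz_dom (m := fun z => g z / f z)
    (fun z hz => (hg z).differentiableWithinAt.div (hf z).differentiableWithinAt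
      (im_div_ne (h1 z hz)).1) (fun z hz => (im_div_ne (h1 z hz)).2)
  obtain ⟨M2, d2, b2⟩ := herglotz_dom (m := fun z => k z / g z)
    (fun z hz => (hk z).differentiableWithinAt.div (hg z).differentiableWithinAt
      (im_div_ne (h2 z hz)).1) (fun z hz => (im_div_ne (h2 z hz)).2)
  obtain ⟨M3, d3, b3⟩ := herglotz_dom (m := fun z => h z / f z)
    (fun z hz => (hh z).differentiableWithinAt.div (hf z).differentiableWithinAt
      (im_div_ne (h3 z hz)).1) (fun z hz => (im_div_ne (h3 z hz)).2)
  have hnorm : ∀ z, ‖2 * f z ^ 2 * (M1 z * M2 z * M3 z)‖ =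
      2 * ‖f z‖ ^ 2 * (‖M1 z‖ * ‖M2 z‖ * ‖M3 z‖) := by intro z; simp
  apply log_int (H := fun z => 2 * f z ^ 2 * (M1 z * M2 z * M3 z)) hf.continuous
  · exact ((hf.pow 2).const_mul 2).differentiableOn.mul ((d1.mul d2).mul d3)
  · intro z hz
    rw [hnorm]
    have f0 := (im_div_ne (h1 z hz)).1
    have g0 := (im_div_ne (h2 z hz)).1
    have id : f z ^ 2 * (g z / f z) * (k z / g z - h z / f z) = 1 := by
      have := hdet z
      field_simp
      linear_combination this
    have id2 : (1 : ℝ) = ‖f z‖ ^ 2 * ‖g z / f z‖ * ‖k z / g z - h z / f z‖ := by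
      rw [← norm_pow, ← norm_mul, ← norm_mul, id, norm_one]
    obtain ⟨p1, q1⟩ := b1 z hz
    obtain ⟨p2, q2⟩ := b2 z hz
    obtain ⟨p3, q3⟩ := b3 z hz
    calc (1 : ℝ) = ‖f z‖ ^ 2 * ‖g z / f z‖ * ‖k z / g z - h z / f z‖ := id2
      _ ≤ ‖f z‖ ^ 2 * ‖M1 z‖ * (2 * (‖M2 z‖ * ‖M3 z‖)) := by
        gcongr
        refine (norm_sub_le _ _).trans ?_
        nlinarith
      _ = _ := by ring
  · intro z hz
    rw [hnorm]
    obtain ⟨p1, q1⟩ := b1 z hz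
    obtain ⟨p2, q2⟩ := b2 z hz
    obtain ⟨p3, q3⟩ := b3 z hz
    have : 1 ≤ ‖M1 z‖ * ‖M2 z‖ * ‖M3 z‖ :=
      one_le_mul_of_one_le_of_one_le (one_le_mul_of_one_le_of_one_le p1 p2) p3
    nlinarith [sq_nonneg ‖f z‖]


lemma exists_zero_of_integral_zero {a b : ℝ} {p q r s : ℝ → ℝ} (hyp : SLHyp a b p q r s)
    {w wq : ℝ → ℂ} {z : ℂ} (hw : SLSys a b p q r s w wq fun x => z * w x)
    {m c : ℝ} (hm : m ∈ Ioo a b) (hc : c ∈ Ioo a b) (hmc : m < c)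
    (hint : IntervalIntegrable (fun t => r t * ‖w t‖ ^ 2) volume m c)
    (h0 : ∫ t in m..c, r t * ‖w t‖ ^ 2 ≤ 0) : ∃ t ∈ Ioo a b, w t = 0 ∧ wq t = 0 := by
  have hsub : Ioo m c ⊆ Ioo a b := Ioo_subset_Ioo hm.1.le hc.2.le
  have hr : ∀ᵐ t ∂(volume.restrict (Ioo m c)), 0 < r t :=
    ae_restrict_of_ae_restrict_of_subset hsub hyp.rpos
  have hp : ∀ᵐ t ∂(volume.restrict (Ioo m c)), p t ≠ 0 :=
    ae_restrict_of_ae_restrict_of_subset hsub hyp.pne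
  have hnn : 0 ≤ᵐ[volume.restrict (Ioo m c)] fun t => r t * ‖w t‖ ^ 2 := by
    filter_upwards [hr] with t ht
    simp only [Pi.zero_apply]; positivity
  rw [intervalIntegral.integral_of_le hmc.le, integral_Ioc_eq_integral_Ioo] at h0
  have hz := (integral_eq_zero_iff_of_nonneg_ae hnn
    ((intervalIntegrable_iff_integrableOn_Ioo_of_le hmc.le).1 hint)).1
      (le_antisymm h0 (integral_nonneg_of_ae hnn))
  have hwae : w =ᵐ[volume.restrict (Ioo m c)] fun _ => 0 := by
    filter_upwards [hr, hz] with t h1 h2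
    simp only [Pi.zero_apply, mul_eq_zero, h1.ne', false_or] at h2
    simpa using h2
  have hw0 : EqOn w (fun _ => 0) (Ioo m c) :=
    Measure.eqOn_open_of_ae_eq hwae isOpen_Ioo (hw.fst.continuousOn.mono hsub) continuousOn_const
  have hd := ae_restrict_of_ae (s := Ioo m c) ((hw.fst c hc m hm).1.ae_hasDerivAt_integral)
  have hall : ∀ᵐ t ∂(volume.restrict (Ioo m c)), t ∈ Ioo a b ∧ w t = 0 ∧ wq t = 0 := by
    filter_upwards [hd, hp, ae_restrict_mem measurableSet_Ioo] with t h1 h2 ht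
    refine ⟨hsub ht, hw0 ht, ?_⟩
    have h3 := h1 (by rw [uIcc_of_le hmc.le]; exact Ioo_subset_Icc_self ht) m Set.left_mem_uIcc
    have h4 : HasDerivAt (fun x => ∫ u in m..x, (wq u / (p u : ℂ) - (s u : ℂ) * w u)) 0 t := by
      refine (hasDerivAt_const t (-w m)).congr_of_eventuallyEq ?_
      filter_upwards [Ioo_mem_nhds ht.1 ht.2] with x hx
      have := (hw.fst x (hsub hx) m hm).2
      have hx0 : w x = 0 := hw0 hx
      rw [hx0] at this
      linear_combination -this
    have h5 := h3.unique h4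
    have hwt : w t = 0 := hw0 ht
    rw [hwt] at h5
    have hpc : (p t : ℂ) ≠ 0 := by exact_mod_cast h2
    simpa [hpc] using h5
  have : (volume.restrict (Ioo m c)) ≠ 0 := by
    rw [Ne, Measure.restrict_eq_zero, Real.volume_Ioo]
    simpa using hmc
  haveI : (ae (volume.restrict (Ioo m c))).NeBot := ae_neBot.2 this
  obtain ⟨t, ht⟩ := hall.exists
  exact ⟨t, ht.1, ht.2⟩

lemma im_sign {a b : ℝ} {p q r s : ℝ → ℝ}
    (hyp : SLHyp a b p q r s) {θ θq φ φq : ℂ → ℝ → ℂ}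
    (hθ : RESolFam a b p q r s θ θq) (hφ : RESolFam a b p q r s φ φq)
    (hW : ∀ z : ℂ, ∀ x ∈ Set.Ioo a b, Wr (θ z) (θq z) (φ z) (φq z) x = 1)
    (hWa1 : ∀ z₁ z₂ : ℂ, Tendsto (Wr (θ z₁) (θq z₁) (φ z₂) (φq z₂)) (𝓝[>] a) (𝓝 1))
    (hWa2 : ∀ z₁ z₂ : ℂ, Tendsto (Wr (θ z₁) (θq z₁) (θ z₂) (θq z₂)) (𝓝[>] a) (𝓝 0))
    (hWa3 : ∀ z₁ z₂ : ℂ, Tendsto (Wr (φ z₁) (φq z₁) (φ z₂) (φq z₂)) (𝓝[>] a) (𝓝 0))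
    {c : ℝ} (hc : c ∈ Set.Ioo a b) {z : ℂ} (hz : 0 < z.im) (A B : ℂ) (hAB : ¬ (A = 0 ∧ B = 0)) :
    (conj (A * θ z c + B * φ z c) * (A * θq z c + B * φq z c)).im < (conj A * B).im := by
  have hw := (hθ.sol z).comb (hφ.sol z) A B
  have hw' := (hθ.sol (conj z)).comb (hφ.sol (conj z)) (conj A) (conj B)
  have L := lagrange hw' hw
  set w : ℝ → ℂ := fun x => A * θ z x + B * φ z x with hwd
  set wq : ℝ → ℂ := fun x => A * θq z x + B * φq z x with hwqd
  set D := Wr (fun x => conj A * θ (conj z) x + conj B * φ (conj z) x)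
    (fun x => conj A * θq (conj z) x + conj B * φq (conj z) x) w wq with hD
  set d : ℝ → ℝ := fun x => (conj (w x) * wq x).im with hd
  have hcw : ∀ x ∈ Ioo a b, conj A * θ (conj z) x + conj B * φ (conj z) x = conj (w x) := by
    intro x hx
    rw [(hθ.real z x hx).1, (hφ.real z x hx).1]; simp [hwd]
  have hcwq : ∀ x ∈ Ioo a b, conj A * θq (conj z) x + conj B * φq (conj z) x = conj (wq x) := by
    intro x hx
    rw [(hθ.real z x hx).2, (hφ.real z x hx).2]; simp [hwqd]
  have hDd : ∀ x ∈ Ioo a b, (D x).im = 2 * d x := by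
    intro x hx
    simp only [hD, Wr, hd]
    rw [hcw x hx, hcwq x hx]
    simp
    ring
  have hlimD : Tendsto D (𝓝[>] a) (𝓝 (conj A * B - conj B * A)) := by
    have t1 := (hWa2 (conj z) z).const_mul (conj A * A)
    have t2 := (hWa1 (conj z) z).const_mul (conj A * B)
    have t3 := (hWa1 z (conj z)).const_mul (conj B * A)
    have t4 := (hWa3 (conj z) z).const_mul (conj B * B)
    have := ((t1.add t2).sub t3).add t4
    simp only [mul_zero, zero_add, mul_one, add_zero] at this
    refine this.congr fun x => ?_
    simp only [hD, Wr, hwd, hwqd]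
    ring
  have hlim : Tendsto d (𝓝[>] a) (𝓝 (conj A * B).im) := by
    have h1 := ((Complex.continuous_im.tendsto _).comp hlimD).div_const 2
    have h2 : (conj A * B - conj B * A).im / 2 = (conj A * B).im := by
      simp; ring
    rw [h2] at h1
    refine h1.congr' ?_
    filter_upwards [Ioo_mem_nhdsGT (hc.1.trans hc.2)] with x hx
    simp only [Function.comp]
    rw [hDd x hx]; ring
  have hii : ∀ x ∈ Ioo a b, ∀ y ∈ Ioo a b, y ≤ x →
      IntervalIntegrable (fun t => r t * ‖w t‖ ^ 2) volume y x := by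
    intro x hx y hy hyx
    apply (hyp.ir x hx y hy).mul_continuousOn
    have : ContinuousOn w (Ioo a b) := hw.fst.continuousOn
    apply (this.mono _).norm.pow 2
    rw [uIcc_of_le hyx]
    exact fun t ht => ⟨hy.1.trans_le ht.1, ht.2.trans_lt hx.2⟩
  have hdiff : ∀ x ∈ Ioo a b, ∀ y ∈ Ioo a b, y ≤ x →
      d x = d y - z.im * ∫ t in y..x, r t * ‖w t‖ ^ 2 := by
    intro x hx y hy hyx
    have h1 := (L x hx y hy).2
    have h2 : ∫ t in y..x, (conj z - z) * ((r t : ℂ) *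
        ((conj A * θ (conj z) t + conj B * φ (conj z) t) * w t)) =
        (conj z - z) * ((∫ t in y..x, r t * ‖w t‖ ^ 2 : ℝ) : ℂ) := by
      rw [intervalIntegral.integral_const_mul, ← intervalIntegral.integral_ofReal]
      congr 1
      apply intervalIntegral.integral_congr
      intro t ht
      rw [uIcc_of_le hyx] at ht
      have ht' : t ∈ Ioo a b := ⟨hy.1.trans_le ht.1, ht.2.trans_lt hx.2⟩
      simp only
      rw [hcw t ht', Complex.conj_mul']
      push_cast
      ring
    rw [h2] at h1
    have h3 := congrArg Complex.im h1
    rw [hDd x hx, Complex.add_im, hDd y hy, Complex.im_mul_ofReal] at h3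
    simp only [Complex.sub_im, Complex.conj_im] at h3
    linarith
  have hnn : ∀ x ∈ Ioo a b, ∀ y ∈ Ioo a b, y ≤ x → 0 ≤ ∫ t in y..x, r t * ‖w t‖ ^ 2 := by
    intro x hx y hy hyx
    rw [intervalIntegral.integral_of_le hyx, integral_Ioc_eq_integral_Ioo]
    apply integral_nonneg_of_ae
    have hr : ∀ᵐ t ∂(volume.restrict (Ioo y x)), 0 < r t :=
      ae_restrict_of_ae_restrict_of_subset (Ioo_subset_Ioo hy.1.le hx.2.le) hyp.rpos
    filter_upwards [hr] with t ht
    simp only [Pi.zero_apply]; positivity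
  obtain ⟨m, hm1, hm2⟩ := exists_between hc.1
  have hm : m ∈ Ioo a b := ⟨hm1, hm2.trans hc.2⟩
  have hpos : 0 < ∫ t in m..c, r t * ‖w t‖ ^ 2 := by
    by_contra hcon
    obtain ⟨t, ht, e1, e2⟩ := exists_zero_of_integral_zero hyp hw hm hc hm2
      (hii c hc m hm hm2.le) (not_lt.1 hcon)
    have hwr := hW z t ht
    simp only [Wr, hwd, hwqd] at hwr e1 e2
    apply hAB
    constructor
    · linear_combination (-A) * hwr + φq z t * e1 - φ z t * e2
    · linear_combination (-B) * hwr - θq z t * e1 + θ z t * e2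
  have hstrict : d c < d m := by
    rw [hdiff c hc m hm hm2.le]
    have := mul_pos hz hpos
    linarith
  have hle : d m ≤ (conj A * B).im := by
    refine ge_of_tendsto hlim ?_
    filter_upwards [Ioo_mem_nhdsGT hm1] with y hy
    have hy' : y ∈ Ioo a b := ⟨hy.1, hy.2.trans hm.2⟩
    rw [hdiff m hm y hy' hy.2.le]
    have := mul_nonneg hz.le (hnn m hm y hy' hy.2.le)
    linarith
  exact hstrict.trans_le hle


/-- If `τ` is in the limit circle case at `a` and `θ_z, φ_z` is a real entire fundamental
system normalized at `a` as in Theorem 4.1, then `z ↦ θ_z(c)`, `z ↦ θ_z^{[1]}(c)`,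
`z ↦ φ_z(c)`, `z ↦ φ_z^{[1]}(c)` belong to the Cartwright class. -/
theorem cartwright_of_limit_circle {a b : ℝ} {p q r s : ℝ → ℝ}
    (hyp : SLHyp a b p q r s) {θ θq φ φq : ℂ → ℝ → ℂ}
    (hθ : RESolFam a b p q r s θ θq) (hφ : RESolFam a b p q r s φ φq)
    (hlc : ∀ z : ℂ, ∀ u uq : ℝ → ℂ, SLSys a b p q r s u uq (fun x => z * u x) →
      ∀ c ∈ Set.Ioo a b, IntegrableOn (fun x => ‖u x‖ ^ 2 * r x) (Set.Ioo a c))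
    (hW : ∀ z : ℂ, ∀ x ∈ Set.Ioo a b, Wr (θ z) (θq z) (φ z) (φq z) x = 1)
    (hWa1 : ∀ z₁ z₂ : ℂ, Tendsto (Wr (θ z₁) (θq z₁) (φ z₂) (φq z₂)) (𝓝[>] a) (𝓝 1))
    (hWa2 : ∀ z₁ z₂ : ℂ, Tendsto (Wr (θ z₁) (θq z₁) (θ z₂) (θq z₂)) (𝓝[>] a) (𝓝 0))
    (hWa3 : ∀ z₁ z₂ : ℂ, Tendsto (Wr (φ z₁) (φq z₁) (φ z₂) (φq z₂)) (𝓝[>] a) (𝓝 0))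
    {c : ℝ} (hc : c ∈ Set.Ioo a b) :
    CartwrightClass (fun z => θ z c) ∧ CartwrightClass (fun z => θq z c) ∧
    CartwrightClass (fun z => φ z c) ∧ CartwrightClass (fun z => φq z c) := by
  obtain ⟨dθ, dθq⟩ := hθ.entire c hc
  obtain ⟨dφ, dφq⟩ := hφ.entire c hc
  have hdet : ∀ z, θ z c * φq z c - θq z c * φ z c = 1 := fun z => hW z c hc
  have sgn := fun (z : ℂ) (hz : 0 < z.im) => im_sign hyp hθ hφ hW hWa1 hWa2 hWa3 hc hz
  -- nonvanishing imaginary parts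
  have I1 : ∀ z : ℂ, 0 < z.im → (conj (θ z c) * θq z c).im ≠ 0 := by
    intro z hz
    have := sgn z hz 1 0 (by simp)
    simp only [one_mul, zero_mul, add_zero, mul_zero, Complex.zero_im] at this
    exact this.ne
  have I2 : ∀ z : ℂ, 0 < z.im → (conj (φ z c) * φq z c).im ≠ 0 := by
    intro z hz
    have := sgn z hz 0 1 (by simp)
    simp only [one_mul, zero_mul, zero_add, map_zero, Complex.zero_im] at this
    exact this.ne
  have I3 : ∀ z : ℂ, 0 < z.im → (conj (θ z c) * φ z c).im ≠ 0 := by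
    intro z hz
    have := sgn z hz (-φ z c) (θ z c) (by
      rintro ⟨e1, e2⟩
      have := hdet z
      rw [neg_eq_zero.1 e1, e2] at this
      simp at this)
    rw [show -φ z c * θ z c + θ z c * φ z c = 0 by ring] at this
    simp at this
    simp
    intro h
    linarith
  have I4 : ∀ z : ℂ, 0 < z.im → (conj (θq z c) * φq z c).im ≠ 0 := by
    intro z hz
    have := sgn z hz (-φq z c) (θq z c) (by
      rintro ⟨e1, e2⟩
      have := hdet z
      rw [neg_eq_zero.1 e1, e2] at this
      simp at this)
    rw [show -φq z c * θq z c + θq z c * φq z c = 0 by ring] at this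
    simp at this
    simp
    intro h
    linarith
  have sw : ∀ u v : ℂ, (conj u * v).im ≠ 0 → (conj v * u).im ≠ 0 := by
    intro u v h h'
    apply h
    simp at *
    linarith
  have ngr : ∀ u v : ℂ, (conj u * v).im ≠ 0 → (conj u * (-v)).im ≠ 0 := by
    intro u v h h'
    apply h
    simp at *
    linarith
  have ngl : ∀ u v : ℂ, (conj u * v).im ≠ 0 → (conj (-u) * v).im ≠ 0 := by
    intro u v h h'
    apply h
    simp at *
    linarith
  -- exponential type
  have hint : IntegrableOn (fun x => (‖θ 0 x‖ + ‖φ 0 x‖) ^ 2 * |r x|) (Ioo a c) := by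
    have h1 := (hlc 0 _ _ (hθ.sol 0) c hc).norm.const_mul 2
    have h2 := (hlc 0 _ _ (hφ.sol 0) c hc).norm.const_mul 2
    have hsub : Ioo a c ⊆ Ioo a b := Ioo_subset_Ioo_right hc.2.le
    have cθ : ContinuousOn (θ 0) (Ioo a c) := (hθ.sol 0).fst.continuousOn.mono hsub
    have cφ : ContinuousOn (φ 0) (Ioo a c) := (hφ.sol 0).fst.continuousOn.mono hsub
    refine (h1.add h2).mono' ?_ (Eventually.of_forall fun x => ?_)
    · exact (((cθ.norm.add cφ.norm).pow 2).aestronglyMeasurable measurableSet_Ioo).mul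
        hyp.mr.abs.aestronglyMeasurable
    · simp only [Real.norm_eq_abs, abs_mul, abs_pow, abs_abs, abs_norm, Pi.add_apply]
      rw [abs_of_nonneg (by positivity : 0 ≤ ‖θ 0 x‖ + ‖φ 0 x‖)]
      have : (‖θ 0 x‖ + ‖φ 0 x‖) ^ 2 ≤ 2 * ‖θ 0 x‖ ^ 2 + 2 * ‖φ 0 x‖ ^ 2 := by
        nlinarith [sq_nonneg (‖θ 0 x‖ - ‖φ 0 x‖)]
      have := mul_le_mul_of_nonneg_right this (abs_nonneg (r x))
      linarith
  set K := 2 * ∫ x in Ioo a c, (‖θ 0 x‖ + ‖φ 0 x‖) ^ 2 * |r x| with hK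
  have bθ : ∀ z, _ := fun z => exp_type (hθ.sol 0) (hφ.sol 0) (hθ.sol z) (hW 0) hc hint
    (hWa2 0 z) (β := -1) ((hWa1 z 0).neg.congr fun x => by simp only [Wr]; ring) (by simp)
  have bφ : ∀ z, _ := fun z => exp_type (hθ.sol 0) (hφ.sol 0) (hφ.sol z) (hW 0) hc hint
    (hWa1 0 z) (hWa3 0 z) (by simp)
  have expand : ∀ (v vq : ℂ), v = (θ 0 c * vq - θq 0 c * v) * φ 0 c -
      (φ 0 c * vq - φq 0 c * v) * θ 0 c ∧ vq = (θ 0 c * vq - θq 0 c * v) * φq 0 c -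
      (φ 0 c * vq - φq 0 c * v) * θq 0 c := by
    intro v vq
    have := hdet 0
    constructor
    · linear_combination (-v) * this
    · linear_combination (-vq) * this
  have nb : ∀ (x y u v : ℂ) (T : ℝ), ‖x‖ + ‖y‖ ≤ T →
      ‖x * u - y * v‖ ≤ (‖u‖ + ‖v‖) * T := by
    intro x y u v T hT
    refine (norm_sub_le _ _).trans ?_
    rw [norm_mul, norm_mul]
    have h1 := norm_nonneg x
    have h2 := norm_nonneg y
    have h3 : ‖x‖ ≤ T := by linarith
    have h4 : ‖y‖ ≤ T := by linarith
    have h5 := mul_le_mul_of_nonneg_right h3 (norm_nonneg u)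
    have h6 := mul_le_mul_of_nonneg_right h4 (norm_nonneg v)
    linarith
  have et : ∀ v vq : ℂ → ℝ → ℂ, (∀ z, ‖Wr (θ 0) (θq 0) (v z) (vq z) c‖ +
      ‖Wr (φ 0) (φq 0) (v z) (vq z) c‖ ≤ Real.exp 2 * Real.exp (K * ‖z‖)) →
      (∃ C τ : ℝ, ∀ z : ℂ, ‖v z c‖ ≤ C * Real.exp (τ * ‖z‖)) ∧
      (∃ C τ : ℝ, ∀ z : ℂ, ‖vq z c‖ ≤ C * Real.exp (τ * ‖z‖)) := by
    intro v vq hb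
    refine ⟨⟨(‖φ 0 c‖ + ‖θ 0 c‖) * Real.exp 2, K, fun z => ?_⟩,
      ⟨(‖φq 0 c‖ + ‖θq 0 c‖) * Real.exp 2, K, fun z => ?_⟩⟩
    · rw [(expand (v z c) (vq z c)).1, mul_assoc]
      exact nb _ _ _ _ _ (hb z)
    · rw [(expand (v z c) (vq z c)).2, mul_assoc]
      exact nb _ _ _ _ _ (hb z)
  obtain ⟨eθ, eθq⟩ := et θ θq bθ
  obtain ⟨eφ, eφq⟩ := et φ φq bφ
  refine ⟨⟨dθ, eθ, ?_⟩, ⟨dθq, eθq, ?_⟩, ⟨dφ, eφ, ?_⟩, ⟨dφq, eφq, ?_⟩⟩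
  · exact log_f (f := fun z => θ z c) (g := fun z => φ z c) (h := fun z => θq z c)
      (k := fun z => φq z c) dθ dφ dθq dφq (fun z => by linear_combination hdet z) I3 I2 I1
  · exact log_f (f := fun z => θq z c) (g := fun z => φq z c) (h := fun z => -θ z c)
      (k := fun z => -φ z c) dθq dφq dθ.neg dφ.neg (fun z => by linear_combination hdet z) I4
      (fun z hz => ngr _ _ (sw _ _ (I2 z hz))) (fun z hz => ngr _ _ (sw _ _ (I1 z hz)))
  · exact log_f (f := fun z => φ z c) (g := fun z => -θ z c) (h := fun z => φq z c)
      (k := fun z => -θq z c) dφ dθ.neg dφq dθq.neg (fun z => by linear_combination hdet z)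
      (fun z hz => ngr _ _ (sw _ _ (I3 z hz))) (fun z hz => ngl _ _ (ngr _ _ (I1 z hz))) I2
  · exact log_f (f := fun z => φq z c) (g := fun z => -θq z c) (h := fun z => -φ z c)
      (k := fun z => θ z c) dφq dθq.neg dφ.neg dθ (fun z => by linear_combination hdet z)
      (fun z hz => ngr _ _ (sw _ _ (I4 z hz))) (fun z hz => ngl _ _ (sw _ _ (I1 z hz)))
      (fun z hz => ngr _ _ (sw _ _ (I2 z hz)))
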